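/- For positive integers n and m, the plethysm p_2 ∘ S_{□(n,m)} equals the sum over all (n,m)-balanced partitions μ ∈ W(n,m) of δ_2(μ)·S_μ. -/

import Mathlib

open scoped BigOperators

/-- A partition, represented canonically as the multiset of its (positive) parts. -/
structure Ptn where
  parts : Multiset ℕ
  pos : ∀ x ∈ parts, 0 < x

namespace Ptn

/-- Build a partition from an arbitrary multiset of naturals by discarding zero parts. -/
def of (s : Multiset ℕ) : Ptn :=
  ⟨s.filter (fun x => 0 < x), fun _ hx => (Multiset.mem_filter.mp hx).2⟩

/-- The empty partition. -/
def empty : Ptn := ⟨0, by simp⟩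

/-- The `i`-th largest part (`0`-indexed); `0` if `i` is at least the number of parts. -/
def part (l : Ptn) (i : ℕ) : ℕ :=
  ((l.parts.sort (· ≤ ·)).reverse).getD i 0

/-- The number of (positive) parts. -/
def length (l : Ptn) : ℕ := Multiset.card l.parts

/-- The size `|λ|`, i.e. the number being partitioned. -/
def size (l : Ptn) : ℕ := l.parts.sum

/-- A partition is strict if all its parts are distinct. -/
def Strict (l : Ptn) : Prop := l.parts.Nodup

/-- The conjugate partition. -/
def conj (l : Ptn) : Ptn :=
  of ((Multiset.range (l.part 0)).map
    (fun j => Multiset.card (l.parts.filter (fun x => j < x))))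

end Ptn

/-- The rectangular partition `□(n,m)` with `n` rows of length `m`. -/
def rect (n m : ℕ) : Ptn := Ptn.of (Multiset.replicate n m)

/-- The partition obtained by multiplying every part by `r`. -/
def scaleP (r : ℕ) (l : Ptn) : Ptn := Ptn.of (l.parts.map (fun a => r * a))

/-- Diagram containment: every part of `small` is at most the corresponding part of `big`. -/
def Contains (big small : Ptn) : Prop := ∀ i, small.part i ≤ big.part i

/-- The beta-set (first-column hook lengths) `{λ_i + m - 1 - i : i < m}` of `l`,
computed with `m` beads (`m` at least the number of parts). -/
def betaSet (l : Ptn) (m : ℕ) : Finset ℕ :=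
  (Finset.range m).image (fun i => l.part i + (m - 1 - i))

/-- The partition encoded by a finite set of bead positions: each bead contributes a part
equal to the number of empty positions (holes) below it. -/
def ptnOfBeads (B : Finset ℕ) : Ptn :=
  Ptn.of (B.val.map (fun p => p - (B.filter (fun q => q < p)).card))

/-- Levels of the beads on runner `k` of the `r`-abacus of `l`,
drawn with `r * l.length` beads (a multiple of `r`). -/
def runnerLevels (r : ℕ) (l : Ptn) (k : ℕ) : Finset ℕ :=
  (Finset.range (l.part 0 + r * l.length + 1)).filter
    (fun s => r * s + k ∈ betaSet l (r * l.length))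

/-- The `k`-th component `λ[k]` of the `r`-quotient of `l`. -/
def quotP (r : ℕ) (l : Ptn) (k : ℕ) : Ptn := ptnOfBeads (runnerLevels r l k)

/-- The `r`-core of `l`: push all beads of the `r`-abacus down as far as possible. -/
def coreP (r : ℕ) (l : Ptn) : Ptn :=
  ptnOfBeads ((Finset.range r).biUnion
    (fun k => (Finset.range (runnerLevels r l k).card).image (fun s => r * s + k)))

/-- The key of the bead at position `p` for the `r`-numbering of the beads `B`:
a bead which is the `j`-th lowest bead on runner `k` gets key `r * j + k`. -/
def rKey (r : ℕ) (B : Finset ℕ) (p : ℕ) : ℕ :=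
  r * (B.filter (fun q => q % r = p % r ∧ q < p)).card + p % r

/-- The number of inversions between the natural (increasing-position) numbering of the
beads `B` and the numbering by increasing `key`. -/
def inversions (key : ℕ → ℕ) (B : Finset ℕ) : ℕ :=
  ((B ×ˢ B).filter (fun pq => pq.1 < pq.2 ∧ key pq.2 < key pq.1)).card

/-- Exponent of the `r`-sign `δ_r`. -/
def rSignExp (r : ℕ) (l : Ptn) : ℕ :=
  inversions (rKey r (betaSet l (r * l.length))) (betaSet l (r * l.length))

/-- The `r`-sign `δ_r(λ) ∈ {±1}`. -/
def rSign (r : ℕ) (l : Ptn) : ℤ := (-1) ^ rSignExp r l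

/-- The key of the bead at position `p` for the `3`-bar numbering of the beads `B` of the
`3`-bar abacus: first the beads of runner `0` in increasing order, then the pairs of beads
on runners `2` and `1` paired off by increasing level (runner-`2` bead before
runner-`1` bead), then the remaining unpaired beads in increasing order. -/
def barKey (B : Finset ℕ) (p : ℕ) : ℕ :=
  let n0 := (B.filter (fun q => q % 3 = 0)).card
  let t := min ((B.filter (fun q => q % 3 = 1)).card)
              ((B.filter (fun q => q % 3 = 2)).card)
  let rk := (B.filter (fun q => q % 3 = p % 3 ∧ q < p)).card
  if p % 3 = 0 then rk
  else if rk < t then (if p % 3 = 2 then n0 + 2 * rk else n0 + 2 * rk + 1)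
  else n0 + 2 * t + (rk - t)

/-- Exponent of the `3`-bar sign `δ̄_3`.  The beads of the `3`-bar abacus of a strict
partition sit at the positions given by the parts. -/
def barSignExp (l : Ptn) : ℕ :=
  inversions (barKey l.parts.toFinset) l.parts.toFinset

/-- The `3`-bar sign `δ̄_3(λ) ∈ {±1}` of a strict partition. -/
def barSign3 (l : Ptn) : ℤ := (-1) ^ barSignExp l

/-- The double `D(λ) = (λ_1,…,λ_l | λ_1 - 1,…,λ_l - 1)` (Frobenius notation)
of a strict partition `λ`, constructed row by row. -/
noncomputable def double (l : Ptn) : Ptn :=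
  Ptn.of ((Multiset.range (l.length + l.part 0)).map (fun i =>
    (if i < l.length then l.part i + 1 else 0) +
      ((Finset.range (min i l.length)).filter (fun j => i + 1 ≤ j + l.part j)).card))

/-- The second component `λ^b[1] = D(λ)[1]` of the `3`-bar quotient of a strict
partition `λ`. -/
noncomputable def barQuot1 (l : Ptn) : Ptn := quotP 3 (double l) 1

/-- The staircase-like strict partition `Λ_ℓ = (3ℓ-2, 3ℓ-5, …, 7, 4, 1)`. -/
def LamP (ℓ : ℕ) : Ptn := Ptn.of ((Multiset.range ℓ).map (fun i => 3 * i + 1))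

/-- The staircase partition `Δ_ℓ = (ℓ, ℓ-1, …, 1)`. -/
def DelP (ℓ : ℕ) : Ptn := Ptn.of (Multiset.range (ℓ + 1))

/-- `F_1^m(Λ_ℓ)`: strict partitions obtained from `Λ_ℓ` by adding `m` cells, each
labelled `1`, where the cell in (0-indexed) column `j` is labelled `1` iff `j % 3 = 1`
(each row reads `0,1,0,0,1,0,…`). -/
def F1Lam (ℓ m : ℕ) : Set Ptn :=
  {mu | mu.Strict ∧ Contains mu (LamP ℓ) ∧ mu.size = (LamP ℓ).size + m ∧
    ∀ i j, (LamP ℓ).part i ≤ j → j < mu.part i → j % 3 = 1}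

/-- `F_1^m(Δ_ℓ)`: partitions obtained from `Δ_ℓ` by adding `m` cells, each labelled `1`,
where the cell `(i,j)` is labelled `1` iff `i + j` is odd. -/
def F1Del (ℓ m : ℕ) : Set Ptn :=
  {mu | Contains mu (DelP ℓ) ∧ mu.size = (DelP ℓ).size + m ∧
    ∀ i j, (DelP ℓ).part i ≤ j → j < mu.part i → (i + j) % 2 = 1}

/-- `(α, β)` is complementary relative to the rectangle `□(n,m)`:
`α ⊆ □(n,m)` and `β_i = m - α_{n+1-i}` for `1 ≤ i ≤ n` (0-indexed below). -/
def Complementary (n m : ℕ) (a b : Ptn) : Prop :=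
  a.length ≤ n ∧ a.part 0 ≤ m ∧ b.length ≤ n ∧
    ∀ i < n, b.part i = m - a.part (n - 1 - i)

/-- `W(n,m)`: the set of `(n,m)`-balanced partitions, i.e. partitions of `2nm` with at
most `2n` parts satisfying `μ_i + μ_{2n+1-i} = 2m` for `1 ≤ i ≤ n` (0-indexed below). -/
def W (n m : ℕ) : Set Ptn :=
  {mu | mu.size = 2 * n * m ∧ mu.length ≤ 2 * n ∧
    ∀ i < n, mu.part i + mu.part (2 * n - 1 - i) = 2 * m}

/-! ### The ring of symmetric functions

We realise the ring of symmetric functions (with rational coefficients) as the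
polynomial ring `ℚ[p_1, p_2, …]` in the power sums: the variable `X n` of
`MvPolynomial ℕ ℚ` stands for the power sum `p_{n+1}`. -/

abbrev SymF := MvPolynomial ℕ ℚ

open MvPolynomial

/-- `z_ρ = ∏ a^{m_a} m_a!` for a partition given as a multiset `ρ`. -/
def zval (s : Multiset ℕ) : ℚ :=
  s.toFinset.prod (fun a => (a : ℚ) ^ s.count a * (Nat.factorial (s.count a) : ℚ))

/-- The power sum product `p_ρ` of a multiset `ρ`. -/
noncomputable def pMult (s : Multiset ℕ) : SymF :=
  (s.map (fun a => (X (a - 1) : SymF))).prod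

/-- The complete homogeneous symmetric function `h_n = Σ_{ρ ⊢ n} z_ρ⁻¹ p_ρ`. -/
noncomputable def hSym (n : ℕ) : SymF :=
  ∑ ρ : Nat.Partition n, (zval ρ.parts)⁻¹ • pMult ρ.parts

/-- `h_k` for an integer index, vanishing for negative `k`. -/
noncomputable def hz (k : ℤ) : SymF := if k < 0 then 0 else hSym k.toNat

/-- The Schur function `S_λ`, via the Jacobi–Trudi formula
`S_λ = det(h_{λ_i - i + j})`. -/
noncomputable def schur (l : Ptn) : SymF :=
  Matrix.det (Matrix.of (fun i j : Fin l.length =>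
    hz ((l.part i.val : ℤ) + (j.val : ℤ) - (i.val : ℤ))))

/-- The plethysm `p_r ∘ f`: the algebra endomorphism sending each power sum `p_k`
to `p_{rk}`, i.e. substituting `x_i^r` for each variable `x_i`. -/
noncomputable def pleth (r : ℕ) (f : SymF) : SymF :=
  MvPolynomial.aeval (fun n => (X (r * (n + 1) - 1) : SymF)) f

/-- The `z`-weight of a power-sum monomial (exponent vector `d`). -/
def zfac (d : ℕ →₀ ℕ) : ℚ :=
  d.prod (fun i e => ((i : ℚ) + 1) ^ e * (Nat.factorial e : ℚ))

/-- The Hall inner product, for which `⟨p_ρ, p_σ⟩ = δ_{ρσ} z_ρ` and the Schur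
functions are orthonormal. -/
noncomputable def hall (f g : SymF) : ℚ :=
  f.support.sum (fun d => f.coeff d * g.coeff d * zfac d)

/-- The multi-Littlewood–Richardson coefficient `LR^λ_{μ^0,…,μ^{r-1}}`:
the multiplicity of `S_λ` in `S_{μ^0} ⋯ S_{μ^{r-1}}`. -/
noncomputable def LRmulti (lam : Ptn) (r : ℕ) (q : ℕ → Ptn) : ℚ :=
  hall ((Finset.range r).prod (fun k => schur (q k))) (schur lam)

/-- The Littlewood–Richardson coefficient `LR^λ_{α,β}`:
the multiplicity of `S_λ` in `S_α · S_β`. -/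
noncomputable def LR2 (lam a b : Ptn) : ℚ := hall (schur a * schur b) (schur lam)

/-- The irreducible symmetric group character `χ^μ(ρ)`, via the Frobenius formula
`χ^μ_ρ = ⟨S_μ, p_ρ⟩`. -/
noncomputable def chi (mu rho : Ptn) : ℚ := hall (schur mu) (pMult rho.parts)

/-- Symmetric functions in two alphabets `u`, `v`: `X (inl n)` is `p_{n+1}(u)` and
`X (inr n)` is `p_{n+1}(v)`. -/
abbrev SymF2 := MvPolynomial (ℕ ⊕ ℕ) ℚ

/-- `f ↦ f(u)`. -/
noncomputable def toU : SymF →ₐ[ℚ] SymF2 :=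
  aeval (fun n => (X (Sum.inl n) : SymF2))

/-- `f ↦ f(v)`. -/
noncomputable def toV : SymF →ₐ[ℚ] SymF2 :=
  aeval (fun n => (X (Sum.inr n) : SymF2))

/-- `f ↦ f(u - v)`, the difference of alphabets: `p_k ↦ p_k(u) - p_k(v)`. -/
noncomputable def toUV : SymF →ₐ[ℚ] SymF2 :=
  aeval (fun n => (X (Sum.inl n) : SymF2) - X (Sum.inr n))

theorem zval_erase {s : Multiset ℕ} {a : ℕ} (ha : a ∈ s) (h0 : a ≠ 0) :
    ((a : ℚ) * s.count a) * (zval s)⁻¹ = (zval (s.erase a))⁻¹ := by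
  have hext : zval (s.erase a) = s.toFinset.prod
      (fun b => (b : ℚ) ^ (s.erase a).count b * (Nat.factorial ((s.erase a).count b) : ℚ)) := by
    refine Finset.prod_subset ?_ ?_
    · intro x hx
      rw [Multiset.mem_toFinset] at *
      exact Multiset.mem_of_mem_erase hx
    · intro x _ hx
      rw [Multiset.mem_toFinset] at hx
      simp [Multiset.count_eq_zero_of_notMem hx]
  have ha' : a ∈ s.toFinset := Multiset.mem_toFinset.2 ha
  have hc : 0 < s.count a := Multiset.count_pos.2 ha
  rw [hext, zval, ← Finset.mul_prod_erase _ _ ha', ← Finset.mul_prod_erase _ _ ha']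
  have hrest : ∏ x ∈ s.toFinset.erase a,
        ((x : ℚ) ^ (s.erase a).count x * (Nat.factorial ((s.erase a).count x) : ℚ))
      = ∏ x ∈ s.toFinset.erase a, ((x : ℚ) ^ s.count x * (Nat.factorial (s.count x) : ℚ)) := by
    refine Finset.prod_congr rfl fun x hx => ?_
    rw [Multiset.count_erase_of_ne (Finset.ne_of_mem_erase hx)]
  rw [hrest, Multiset.count_erase_self]
  obtain ⟨c, hc'⟩ : ∃ c, s.count a = c + 1 := ⟨_, (Nat.succ_pred_eq_of_pos hc).symm⟩
  rw [hc']
  have h0' : (a : ℚ) ≠ 0 := by exact_mod_cast h0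
  have hf : (Nat.factorial c : ℚ) ≠ 0 := by exact_mod_cast Nat.factorial_ne_zero c
  have hc1 : (c : ℚ) + 1 ≠ 0 := by positivity
  simp only [Nat.add_sub_cancel, Nat.factorial_succ, pow_succ, mul_inv]
  push_cast
  field_simp

theorem pMult_cons (a : ℕ) (s : Multiset ℕ) : pMult (a ::ₘ s) = X (a - 1) * pMult s := by
  simp [pMult]

/-- Newton's identity `n h_n = ∑ p_a h_{n-a}`. -/
theorem newton_hSym (n : ℕ) :
    (n : SymF) * hSym n = ∑ a ∈ Finset.Icc 1 n, (X (a - 1) : SymF) * hSym (n - a) := by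
  have h1 : ∀ ρ : Nat.Partition n, (n : SymF) * ((zval ρ.parts)⁻¹ • pMult ρ.parts)
      = ∑ a ∈ ρ.parts.toFinset, (X (a - 1) : SymF) *
          ((zval (ρ.parts.erase a))⁻¹ • pMult (ρ.parts.erase a)) := by
    intro ρ
    have hn : (n : ℚ) = ∑ a ∈ ρ.parts.toFinset, ((a : ℚ) * ρ.parts.count a) := by
      conv_lhs => rw [← ρ.parts_sum, Finset.sum_multiset_count]
      push_cast
      exact Finset.sum_congr rfl fun a _ => by rw [smul_eq_mul]; push_cast; ring
    have : (n : SymF) * ((zval ρ.parts)⁻¹ • pMult ρ.parts)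
        = ((n : ℚ) * (zval ρ.parts)⁻¹) • pMult ρ.parts := by
      rw [mul_smul, Nat.cast_smul_eq_nsmul, nsmul_eq_mul]
    rw [this, hn, Finset.sum_mul, Finset.sum_smul]
    refine Finset.sum_congr rfl fun a ha => ?_
    have ha' := Multiset.mem_toFinset.1 ha
    rw [zval_erase ha' (ρ.parts_pos ha').ne', mul_smul_comm, ← pMult_cons,
      Multiset.cons_erase ha']
  rw [hSym, Finset.mul_sum, Finset.sum_congr rfl fun ρ _ => h1 ρ]
  simp only [hSym, Finset.mul_sum]
  rw [Finset.sum_sigma', Finset.sum_sigma']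
  refine Finset.sum_bij'
    (i := fun x hx => ⟨x.2, ⟨x.1.parts.erase x.2, ?_, ?_⟩⟩)
    (j := fun y hy => ⟨⟨y.1 ::ₘ y.2.parts, ?_, ?_⟩, y.1⟩) ?_ ?_ ?_ ?_ ?_
  · exact fun h => x.1.parts_pos (Multiset.mem_of_mem_erase h)
  · have h := Multiset.mem_toFinset.1 (Finset.mem_sigma.1 hx).2
    have := Multiset.sum_erase h
    rw [x.1.parts_sum] at this
    omega
  · intro i h
    have h1 := Finset.mem_Icc.1 (Finset.mem_sigma.1 hy).1
    rcases Multiset.mem_cons.1 h with h | h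
    · omega
    · exact y.2.parts_pos h
  · have h1 := Finset.mem_Icc.1 (Finset.mem_sigma.1 hy).1
    rw [Multiset.sum_cons, y.2.parts_sum]
    omega
  · rintro ⟨ρ, a⟩ hx
    have h := Multiset.mem_toFinset.1 (Finset.mem_sigma.1 hx).2
    simp only [Finset.mem_sigma, Finset.mem_Icc, Finset.mem_univ, and_true]
    exact ⟨ρ.parts_pos h, by
      have := Multiset.single_le_sum (fun _ _ => Nat.zero_le _) _ h
      rwa [ρ.parts_sum] at this⟩
  · rintro ⟨a, ρ⟩ _
    simp
  · rintro ⟨ρ, a⟩ hx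
    have h := Multiset.mem_toFinset.1 (Finset.mem_sigma.1 hx).2
    simp only [Sigma.mk.injEq, heq_eq_eq, and_true]
    exact Nat.Partition.ext (Multiset.cons_erase h)
  · rintro ⟨a, ρ⟩ _
    simp
  · rintro ⟨ρ, a⟩ _
    rfl

theorem hSym_zero : hSym 0 = 1 := by
  simp [hSym, zval, pMult]

/-- The plethysm `f ↦ p_r ∘ f` as an algebra homomorphism. -/
noncomputable def plethHom (r : ℕ) : SymF →ₐ[ℚ] SymF :=
  MvPolynomial.aeval (fun n => (X (r * (n + 1) - 1) : SymF))

theorem pleth_eq (r : ℕ) (f : SymF) : pleth r f = plethHom r f := rfl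

namespace PowerSeries

/-- The Euler operator `t d/dt`. -/
noncomputable def euler {R : Type*} [CommRing R] (F : PowerSeries R) : PowerSeries R :=
  PowerSeries.X * d⁄dX R F

variable {R : Type*} [CommRing R]

theorem coeff_euler (F : PowerSeries R) (n : ℕ) : coeff n (euler F) = n * coeff n F := by
  cases n with
  | zero => simp [euler]
  | succ n => rw [euler, coeff_succ_X_mul, coeff_derivative]; push_cast; ring

theorem euler_mul (F G : PowerSeries R) : euler (F * G) = euler F * G + F * euler G := by
  simp only [euler, Derivation.leibniz, smul_eq_mul]; ring

/-- A solution of `t F' = F E` with `E` divisible by `t` is determined by its constant term. -/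
theorem eq_of_euler_eq [IsDomain R] [CharZero R] {F G E : PowerSeries R}
    (hE : constantCoeff E = 0) (hF : euler F = F * E) (hG : euler G = G * E)
    (h0 : constantCoeff F = constantCoeff G) : F = G := by
  ext n
  induction n using Nat.strong_induction_on with
  | _ n ih =>
    rcases Nat.eq_zero_or_pos n with rfl | hn
    · simpa using h0
    · have key : (n : R) * coeff n F = n * coeff n G := by
        rw [← coeff_euler, ← coeff_euler, hF, hG, coeff_mul, coeff_mul]
        refine Finset.sum_congr rfl fun x hx => ?_
        have hx' := Finset.HasAntidiagonal.mem_antidiagonal.1 hx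
        rcases Nat.eq_zero_or_pos x.2 with h | h
        · simp [h, hE]
        · rw [ih x.1 (by omega)]
      exact mul_left_cancel₀ (by exact_mod_cast hn.ne') key

end PowerSeries

/-- The generating series of the complete symmetric functions. -/
noncomputable def hSeries : PowerSeries SymF := PowerSeries.mk hSym

/-- The generating series of the power sums. -/
noncomputable def pSeries : PowerSeries SymF :=
  PowerSeries.mk fun k => if k = 0 then 0 else X (k - 1)

theorem euler_hSeries : PowerSeries.euler hSeries = hSeries * pSeries := by
  ext1 n
  rw [PowerSeries.coeff_euler, hSeries, PowerSeries.coeff_mk, newton_hSym, mul_comm,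
    PowerSeries.coeff_mul, Finset.Nat.sum_antidiagonal_eq_sum_range_succ_mk]
  simp only [pSeries, PowerSeries.coeff_mk, ite_mul, zero_mul]
  rw [Finset.sum_ite, Finset.sum_const_zero, zero_add]
  refine Finset.sum_congr ?_ fun _ _ => rfl
  ext a
  simp only [Finset.mem_Icc, Finset.mem_filter, Finset.mem_range]
  omega

/-- `∑ (p_2 ∘ h_k) t^{2k} = H(t) H(-t)`. -/
theorem expand_pleth_hSeries :
    PowerSeries.expand 2 two_ne_zero (hSeries.map (plethHom 2).toRingHom)
      = PowerSeries.rescale (-1) hSeries * hSeries := by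
  have hresc : PowerSeries.euler (PowerSeries.rescale (-1) hSeries)
      = PowerSeries.rescale (-1) hSeries * PowerSeries.rescale (-1) pSeries := by
    rw [← map_mul, ← euler_hSeries]
    ext1 n
    simp only [PowerSeries.coeff_euler, PowerSeries.coeff_rescale]
    ring
  have hP : PowerSeries.rescale (-1) pSeries + pSeries
      = 2 * PowerSeries.expand 2 two_ne_zero (pSeries.map (plethHom 2).toRingHom) := by
    ext1 n
    have h2 : (2 : PowerSeries SymF) = PowerSeries.C 2 := (map_ofNat PowerSeries.C 2).symm
    rw [h2, PowerSeries.coeff_C_mul, PowerSeries.coeff_expand, map_add,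
      PowerSeries.coeff_rescale]
    split_ifs with h
    · obtain ⟨k, rfl⟩ := h
      rcases Nat.eq_zero_or_pos k with rfl | hk
      · simp [pSeries]
      · have : 2 * k - 1 = 2 * (k - 1 + 1) - 1 := by omega
        rw [Nat.mul_div_cancel_left k two_pos, PowerSeries.coeff_map, pSeries,
          PowerSeries.coeff_mk, PowerSeries.coeff_mk, if_neg (by omega), if_neg hk.ne',
          pow_mul, neg_one_sq, one_pow, this]
        simp only [AlgHom.toRingHom_eq_coe, RingHom.coe_coe, plethHom, aeval_X]
        ring
    · rw [(Nat.not_even_iff_odd.1 fun h' => h h'.two_dvd).neg_one_pow]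
      ring
  have h0 : PowerSeries.constantCoeff pSeries = 0 := by
    rw [← PowerSeries.coeff_zero_eq_constantCoeff_apply]; simp [pSeries]
  have h1 : PowerSeries.constantCoeff hSeries = 1 := by
    rw [← PowerSeries.coeff_zero_eq_constantCoeff_apply]; simp [hSeries, hSym_zero]
  have hconst : ∀ F : PowerSeries SymF, PowerSeries.constantCoeff (PowerSeries.rescale (-1) F)
      = PowerSeries.constantCoeff F := by
    intro F
    rw [← PowerSeries.coeff_zero_eq_constantCoeff_apply, PowerSeries.coeff_rescale, pow_zero,
      one_mul, PowerSeries.coeff_zero_eq_constantCoeff_apply]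
  refine PowerSeries.eq_of_euler_eq (E := PowerSeries.rescale (-1) pSeries + pSeries)
    ?_ ?_ ?_ ?_
  · rw [map_add, hconst, h0, add_zero]
  · rw [hP]
    have : PowerSeries.euler (PowerSeries.expand 2 two_ne_zero
        (hSeries.map (plethHom 2).toRingHom)) = 2 * PowerSeries.expand 2 two_ne_zero
        ((PowerSeries.euler hSeries).map (plethHom 2).toRingHom) := by
      ext1 n
      have h2 : (2 : PowerSeries SymF) = PowerSeries.C 2 := (map_ofNat PowerSeries.C 2).symm
      rw [h2, PowerSeries.coeff_C_mul, PowerSeries.coeff_euler, PowerSeries.coeff_expand,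
        PowerSeries.coeff_expand]
      split_ifs with h
      · obtain ⟨k, rfl⟩ := h
        simp [PowerSeries.coeff_euler, mul_assoc]
      · simp
    rw [this, euler_hSeries, map_mul, map_mul]
    ring
  · rw [PowerSeries.euler_mul, hresc, euler_hSeries]
    ring
  · rw [PowerSeries.constantCoeff_expand, map_mul, hconst, h1,
      ← PowerSeries.coeff_zero_eq_constantCoeff_apply, PowerSeries.coeff_map,
      PowerSeries.coeff_zero_eq_constantCoeff_apply, h1, map_one, one_mul]

/-- The alternating convolution of complete symmetric functions, shifted by `j` and `k`. -/
theorem sum_alternating_hz (N j k : ℕ) :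
    ∑ x ∈ Finset.range (N + 1), (-1 : SymF) ^ x * (hz ((x : ℤ) - j) * hz (((N - x : ℕ) : ℤ) - k))
      = (-1) ^ j * if (2 : ℤ) ∣ (N : ℤ) - j - k then
          plethHom 2 (hz (((N : ℤ) - j - k) / 2)) else 0 := by
  have hshift : ∀ x d : ℕ, hz ((x : ℤ) - d)
      = PowerSeries.coeff x (PowerSeries.X ^ d * hSeries) := by
    intro x d
    rw [PowerSeries.coeff_X_pow_mul', hz]
    by_cases h : d ≤ x
    · rw [if_pos h, if_neg (by omega), hSeries, PowerSeries.coeff_mk]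
      congr 1; omega
    · rw [if_neg h, if_pos (by omega)]
  have hsign : ∀ x d : ℕ, (-1 : SymF) ^ x * hz ((x : ℤ) - d) = (-1) ^ d *
      PowerSeries.coeff x (PowerSeries.X ^ d * PowerSeries.rescale (-1) hSeries) := by
    intro x d
    rw [hshift, PowerSeries.coeff_X_pow_mul', PowerSeries.coeff_X_pow_mul']
    split_ifs with h
    · rw [PowerSeries.coeff_rescale, ← mul_assoc, ← pow_add, Nat.add_sub_cancel' h]
    · simp
  have hconv : ∑ x ∈ Finset.range (N + 1),
      (-1 : SymF) ^ x * (hz ((x : ℤ) - j) * hz (((N - x : ℕ) : ℤ) - k))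
      = (-1) ^ j * PowerSeries.coeff N (PowerSeries.X ^ (j + k) *
          (PowerSeries.rescale (-1) hSeries * hSeries)) := by
    rw [show (PowerSeries.X : PowerSeries SymF) ^ (j + k) *
          (PowerSeries.rescale (-1) hSeries * hSeries)
        = (PowerSeries.X ^ j * PowerSeries.rescale (-1) hSeries) *
          (PowerSeries.X ^ k * hSeries) by rw [pow_add]; ring,
      PowerSeries.coeff_mul, Finset.Nat.sum_antidiagonal_eq_sum_range_succ_mk, Finset.mul_sum]
    refine Finset.sum_congr rfl fun x _ => ?_
    rw [← mul_assoc, hsign, hshift, mul_assoc]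
  rw [hconv, ← expand_pleth_hSeries, PowerSeries.coeff_X_pow_mul']
  congr 1
  by_cases h : j + k ≤ N
  · rw [if_pos h, PowerSeries.coeff_expand]
    by_cases hd : 2 ∣ N - (j + k)
    · rw [if_pos hd, if_pos (by omega), hz, if_neg (by omega), PowerSeries.coeff_map, hSeries,
        PowerSeries.coeff_mk]
      have : (((N : ℤ) - j - k) / 2).toNat = (N - (j + k)) / 2 := by omega
      rw [this]
      rfl
    · rw [if_neg hd, if_neg (by omega)]
  · rw [if_neg h]
    split_ifs with hd
    · rw [hz, if_pos (by omega), map_zero]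
    · rfl

section PairDet

variable {R S : Type*} [CommRing R] {n : ℕ}

/-- The determinant whose rows, in order, are `a (e 0), b (e 0), a (e 1), b (e 1), …`. -/
def pairDet (a b : S → Fin n × Fin 2 → R) (e : Fin n → S) : R :=
  Matrix.det (Matrix.of fun x : Fin n × Fin 2 => if x.2 = 0 then a (e x.1) else b (e x.1))

theorem sum_perm_fin_two {M : Type*} [AddCommMonoid M] (f : Equiv.Perm (Fin 2) → M) :
    ∑ π, f π = f 1 + f (Equiv.swap 0 1) := by
  have h : (Finset.univ : Finset (Equiv.Perm (Fin 2))) = {1, Equiv.swap 0 1} := by decide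
  rw [h, Finset.sum_pair (by decide)]

theorem pairDet_eq_sum (a b : S → Fin n × Fin 2 → R) (e : Fin n → S) :
    pairDet a b e = ∑ σ : Equiv.Perm (Fin n × Fin 2), ((Equiv.Perm.sign σ : ℤ) : R) *
      ∏ i, (a (e i) (σ (i, 0)) * b (e i) (σ (i, 1))) := by
  rw [pairDet, ← Matrix.det_transpose, Matrix.det_apply']
  refine Finset.sum_congr rfl fun σ _ => ?_
  rw [Fintype.prod_prod_type]
  simp [Fin.prod_univ_two]

theorem sum_pairDet_eq [Fintype S] (a b : S → Fin n × Fin 2 → R) :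
    ∑ e, pairDet a b e = ∑ σ : Equiv.Perm (Fin n × Fin 2), ((Equiv.Perm.sign σ : ℤ) : R) *
      ∏ i, ∑ s, (a s (σ (i, 0)) * b s (σ (i, 1))) := by
  simp only [pairDet_eq_sum]
  rw [Finset.sum_comm]
  refine Finset.sum_congr rfl fun σ _ => ?_
  rw [← Finset.mul_sum, Fintype.prod_sum]

/-- Antisymmetrising the bilinear form inside a sum over permutations of paired indices. -/
theorem sum_perm_antisymm (B : Fin n × Fin 2 → Fin n × Fin 2 → R) :
    ∑ σ : Equiv.Perm (Fin n × Fin 2), ((Equiv.Perm.sign σ : ℤ) : R) *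
        ∏ i, (B (σ (i, 0)) (σ (i, 1)) - B (σ (i, 1)) (σ (i, 0)))
      = 2 ^ n * ∑ σ : Equiv.Perm (Fin n × Fin 2), ((Equiv.Perm.sign σ : ℤ) : R) *
        ∏ i, B (σ (i, 0)) (σ (i, 1)) := by
  have h : ∀ σ : Equiv.Perm (Fin n × Fin 2),
      ∏ i, (B (σ (i, 0)) (σ (i, 1)) - B (σ (i, 1)) (σ (i, 0)))
        = ∑ f : Fin n → Equiv.Perm (Fin 2), ∏ i, (((Equiv.Perm.sign (f i) : ℤ) : R) *
            B (σ (i, f i 0)) (σ (i, f i 1))) := by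
    intro σ
    rw [← Fintype.prod_sum fun (i : Fin n) (π : Equiv.Perm (Fin 2)) =>
      ((Equiv.Perm.sign π : ℤ) : R) * B (σ (i, π 0)) (σ (i, π 1))]
    refine Finset.prod_congr rfl fun i _ => ?_
    rw [sum_perm_fin_two]
    simp [sub_eq_add_neg]
  simp only [h, Finset.mul_sum]
  rw [Finset.sum_comm]
  have h2 : ∀ f : Fin n → Equiv.Perm (Fin 2),
      ∑ σ : Equiv.Perm (Fin n × Fin 2), ((Equiv.Perm.sign σ : ℤ) : R) *
        ∏ i, (((Equiv.Perm.sign (f i) : ℤ) : R) * B (σ (i, f i 0)) (σ (i, f i 1)))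
      = ∑ σ : Equiv.Perm (Fin n × Fin 2), ((Equiv.Perm.sign σ : ℤ) : R) *
        ∏ i, B (σ (i, 0)) (σ (i, 1)) := by
    intro f
    rw [← Equiv.sum_comp (Equiv.mulRight (Equiv.prodCongrRight f))
      fun σ : Equiv.Perm (Fin n × Fin 2) => ((Equiv.Perm.sign σ : ℤ) : R) *
        ∏ i, B (σ (i, 0)) (σ (i, 1))]
    refine Finset.sum_congr rfl fun σ _ => ?_
    rw [Equiv.coe_mulRight, map_mul, Equiv.Perm.sign_prodCongrRight, Finset.prod_mul_distrib,
      Units.val_mul, Units.coe_prod, Int.cast_mul, Int.cast_prod, mul_assoc]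
    rfl
  simp only [h2]
  rw [Finset.sum_const, Finset.card_univ, Fintype.card_fun, Fintype.card_perm, Fintype.card_fin,
    Fintype.card_fin, nsmul_eq_mul, Finset.mul_sum]
  simp

/-- The sum of all `pairDet`s depends only on the antisymmetric form `∑ a ∧ b`. -/
theorem sum_pairDet_congr {S' : Type*} [Fintype S] [Fintype S'] [IsDomain R] [CharZero R]
    {a b : S → Fin n × Fin 2 → R} {a' b' : S' → Fin n × Fin 2 → R}
    (h : ∀ x y, ∑ s, (a s x * b s y - a s y * b s x)
      = ∑ s, (a' s x * b' s y - a' s y * b' s x)) :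
    ∑ e, pairDet a b e = ∑ e, pairDet a' b' e := by
  have h2 : (2 : R) ^ n ≠ 0 := pow_ne_zero _ two_ne_zero
  refine mul_left_cancel₀ h2 ?_
  rw [sum_pairDet_eq, sum_pairDet_eq,
    ← sum_perm_antisymm fun x y => ∑ s, a s x * b s y,
    ← sum_perm_antisymm fun x y => ∑ s, a' s x * b' s y]
  simp only [← Finset.sum_sub_distrib, h]

theorem pairDet_comp_perm (a b : S → Fin n × Fin 2 → R) (e : Fin n → S)
    (τ : Equiv.Perm (Fin n)) : pairDet a b (e ∘ τ) = pairDet a b e := by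
  have := Matrix.det_permute (Equiv.prodCongrLeft fun _ : Fin 2 => τ)
    (Matrix.of fun x : Fin n × Fin 2 => if x.2 = 0 then a (e x.1) else b (e x.1))
  rw [Equiv.Perm.sign_prodCongrLeft, Fin.prod_univ_two, Int.units_mul_self] at this
  rw [Units.val_one, Int.cast_one, one_mul] at this
  exact this

theorem pairDet_eq_zero (a b : S → Fin n × Fin 2 → R) {e : Fin n → S}
    (he : ¬ Function.Injective e) : pairDet a b e = 0 := by
  simp only [Function.Injective, not_forall] at he
  obtain ⟨i, j, hij, hne⟩ := he
  refine Matrix.det_zero_of_row_eq (i := (i, 0)) (j := (j, 0)) (by simpa using hne) ?_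
  ext y
  simp [hij]

/-- Summing a symmetric function of tuples that vanishes on non-injective ones. -/
theorem sum_fun_eq_factorial_mul [Fintype S] [LinearOrder S] (f : (Fin n → S) → R)
    (h0 : ∀ e, ¬ Function.Injective e → f e = 0)
    (hs : ∀ e (τ : Equiv.Perm (Fin n)), f (e ∘ τ) = f e) :
    ∑ e, f e = (n.factorial : R) * ∑ E : {E : Finset S // E.card = n},
      f (E.1.orderEmbOfFin E.2) := by
  classical
  have h1 : ∑ e, f e = ∑ x : {E : Finset S // E.card = n} × Equiv.Perm (Fin n),
      f (x.1.1.orderEmbOfFin x.1.2 ∘ x.2) := by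
    rw [← Finset.sum_filter_of_ne (p := Function.Injective)
      (fun e _ h => by by_contra h'; exact h (h0 e h'))]
    symm
    refine Finset.sum_bij (fun x _ => x.1.1.orderEmbOfFin x.1.2 ∘ x.2) ?_ ?_ ?_ ?_
    · rintro ⟨E, τ⟩ _
      simpa using E.1.orderEmbOfFin E.2 |>.injective
    · rintro ⟨⟨E, hE⟩, τ⟩ _ ⟨⟨E', hE'⟩, τ'⟩ _ h
      dsimp only at h
      have hEE : E = E' := by
        have := congrArg Set.range h
        rw [Set.range_comp, Set.range_comp, τ.surjective.range_eq, τ'.surjective.range_eq,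
          Set.image_univ, Set.image_univ, Finset.range_orderEmbOfFin,
          Finset.range_orderEmbOfFin] at this
        exact_mod_cast this
      subst hEE
      have : τ = τ' := by
        ext i
        exact congrArg Fin.val ((E.orderEmbOfFin hE).injective (congrFun h i))
      rw [this]
    · intro e he
      have he' : Function.Injective e := (Finset.mem_filter.1 he).2
      have hc : (Finset.univ.image e).card = n := by
        rw [Finset.card_image_of_injective _ he', Finset.card_univ, Fintype.card_fin]
      set g := (Finset.univ.image e).orderEmbOfFin hc with hg
      have hr : ∀ i, ∃ j, g j = e i := by
        intro i
        have : e i ∈ Set.range g := by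
          rw [hg, Finset.range_orderEmbOfFin]; simp
        exact this
      choose τ hτ using hr
      have hinj : Function.Injective τ := by
        intro i j hij
        apply he'
        rw [← hτ i, ← hτ j, hij]
      refine ⟨⟨⟨_, hc⟩, Equiv.ofBijective τ (Finite.injective_iff_bijective.1 hinj)⟩,
        Finset.mem_univ _, ?_⟩
      funext i
      exact hτ i
    · intro _ _
      rfl
  rw [h1, Fintype.sum_prod_type]
  rw [Finset.mul_sum]
  refine Finset.sum_congr rfl fun E _ => ?_
  refine (Finset.sum_congr rfl fun τ _ => hs (E.1.orderEmbOfFin E.2) τ).trans ?_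
  rw [Finset.sum_const, Finset.card_univ, Fintype.card_perm, Fintype.card_fin, nsmul_eq_mul]

/-- If `∑ a ∧ b` is the form with block matrix `(0, C; -Cᵀ, 0)`, the signed minors
`pairDet` sum to `det C`. -/
theorem sum_pairDet_eq_det [Fintype S] [LinearOrder S] [IsDomain R] [CharZero R]
    (a b : S → Fin n × Fin 2 → R) (C : Matrix (Fin n) (Fin n) R)
    (h01 : ∀ j k, ∑ s, (a s (j, 0) * b s (k, 1) - a s (k, 1) * b s (j, 0)) = C j k)
    (h00 : ∀ j k, ∑ s, (a s (j, 0) * b s (k, 0) - a s (k, 0) * b s (j, 0)) = 0)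
    (h11 : ∀ j k, ∑ s, (a s (j, 1) * b s (k, 1) - a s (k, 1) * b s (j, 1)) = 0) :
    ∑ E : {E : Finset S // E.card = n}, pairDet a b (E.1.orderEmbOfFin E.2) = C.det := by
  set a' : Fin n → Fin n × Fin 2 → R := fun k x => if x.2 = 0 then C x.1 k else 0 with ha'
  set b' : Fin n → Fin n × Fin 2 → R := fun k x => if x = (k, 1) then 1 else 0 with hb'
  have key : ∑ e, pairDet a b e = ∑ e, pairDet a' b' e := by
    refine sum_pairDet_congr ?_
    have h10 : ∀ j k, ∑ s, (a s (k, 1) * b s (j, 0) - a s (j, 0) * b s (k, 1)) = - C j k := by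
      intro j k
      rw [← h01, ← Finset.sum_neg_distrib]
      exact Finset.sum_congr rfl fun _ _ => (neg_sub _ _).symm
    rintro ⟨j, c⟩ ⟨k, d⟩
    fin_cases c <;> fin_cases d
    · simpa [ha', hb'] using h00 j k
    · simpa [ha', hb'] using h01 j k
    · simpa [ha', hb'] using h10 k j
    · simpa [ha', hb'] using h11 j k
  have hC : pairDet a' b' id = C.det := by
    have : (Matrix.of fun x : Fin n × Fin 2 => if x.2 = 0 then a' (id x.1) else b' (id x.1))
        = Matrix.blockDiagonal fun c : Fin 2 => if c = 0 then C.transpose else 1 := by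
      ext ⟨i, c⟩ ⟨j, d⟩
      rw [Matrix.blockDiagonal_apply]
      fin_cases c <;> fin_cases d <;> simp [ha', hb', Matrix.one_apply, eq_comm]
    rw [pairDet, this, Matrix.det_blockDiagonal, Fin.prod_univ_two]
    simp
  have hf : (n.factorial : R) ≠ 0 := by exact_mod_cast n.factorial_ne_zero
  refine mul_left_cancel₀ hf ?_
  rw [← sum_fun_eq_factorial_mul _ (fun e he => pairDet_eq_zero a b he)
    (pairDet_comp_perm a b), key, sum_fun_eq_factorial_mul _
    (fun e he => pairDet_eq_zero a' b' he) (pairDet_comp_perm a' b')]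
  congr 1
  rw [← hC, Fintype.sum_eq_single ⟨Finset.univ, by simp⟩]
  · congr 1
    exact (Finset.orderEmbOfFin_unique _ (fun _ => Finset.mem_univ _) strictMono_id).symm
  · rintro ⟨E, hE⟩ hne
    refine absurd ?_ hne
    simp only [Subtype.mk.injEq]
    exact Finset.eq_univ_of_card _ (by simpa using hE)

end PairDet

namespace Ptn

theorem getD_filter_pos {L : List ℕ} (hL : L.Pairwise (· ≥ ·)) (i : ℕ) :
    (L.filter (fun x => 0 < x)).getD i 0 = L.getD i 0 := by
  induction L generalizing i with
  | nil => rfl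
  | cons x L ih =>
    rw [List.pairwise_cons] at hL
    by_cases hx : 0 < x
    · rw [List.filter_cons_of_pos (by simpa using hx)]
      cases i with
      | zero => rfl
      | succ i => simpa using ih hL.2 i
    · have h0 : ∀ y ∈ x :: L, y = 0 := by
        intro y hy
        rcases List.mem_cons.1 hy with h | h
        · omega
        · have := hL.1 y h
          omega
      have hnil : (x :: L).filter (fun x => 0 < x) = [] := by
        rw [List.filter_eq_nil_iff]
        intro y hy
        simp [h0 y hy]
      rw [hnil, List.getD_nil, List.getD_eq_getElem?_getD]
      rcases h : (x :: L)[i]? with _ | y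
      · rfl
      · exact (h0 y (List.mem_of_getElem? h)).symm

theorem part_of {L : List ℕ} (hL : L.Pairwise (· ≥ ·)) (i : ℕ) :
    (Ptn.of (L : Multiset ℕ)).part i = L.getD i 0 := by
  have h : ((Ptn.of (L : Multiset ℕ)).parts.sort (· ≤ ·)).reverse
      = L.filter (fun x => 0 < x) := by
    refine List.Perm.eq_of_pairwise' (r := (· ≥ ·)) ?_ (hL.filter _) ?_
    · rw [List.pairwise_reverse]
      exact Multiset.pairwise_sort _ _
    · refine (List.reverse_perm _).trans ?_
      rw [← Multiset.coe_eq_coe, Multiset.sort_eq]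
      rfl
  rw [part, h, getD_filter_pos hL]

theorem part_eq_zero {l : Ptn} {i : ℕ} (h : l.length ≤ i) : l.part i = 0 := by
  rw [part, List.getD_eq_default]
  simpa [length] using h

theorem part_antitone (l : Ptn) : Antitone l.part := by
  intro i j hij
  by_cases hj : l.length ≤ j
  · rw [part_eq_zero hj]
    exact Nat.zero_le _
  · have hlen : ((l.parts.sort (· ≤ ·)).reverse).length = l.length := by simp [length]
    rw [part, part, List.getD_eq_getElem _ _ (by omega), List.getD_eq_getElem _ _ (by omega)]
    have hp : ((l.parts.sort (· ≤ ·)).reverse).Pairwise (· ≥ ·) := by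
      rw [List.pairwise_reverse]
      exact Multiset.pairwise_sort _ _
    exact hp.sortedGE.antitone_get (a := ⟨i, by omega⟩) (b := ⟨j, by omega⟩) hij

theorem filter_map_part (l : Ptn) {M : ℕ} (hM : l.length ≤ M) :
    ((Multiset.range M).map l.part).filter (fun x => 0 < x) = l.parts := by
  have hlen : ((l.parts.sort (· ≤ ·)).reverse).length = l.length := by simp [length]
  have h : (List.range M).map l.part
      = (l.parts.sort (· ≤ ·)).reverse ++ List.replicate (M - l.length) 0 := by
    refine List.ext_getElem (by
      rw [List.length_append, hlen, List.length_map, List.length_range, List.length_replicate]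
      omega) fun i h1 h2 => ?_
    rw [List.getElem_map, List.getElem_range, List.getElem_append]
    split_ifs with h
    · rw [part, List.getD_eq_getElem _ _ h]
    · rw [List.getElem_replicate, part_eq_zero (by omega)]
  have hcoe : (Multiset.range M).map l.part = l.parts + Multiset.replicate (M - l.length) 0 := by
    have : (Multiset.range M).map l.part = (((List.range M).map l.part : List ℕ) : Multiset ℕ) :=
      rfl
    rw [this, h, ← Multiset.coe_add, Multiset.coe_reverse, Multiset.sort_eq,
      Multiset.coe_replicate]
  rw [hcoe, Multiset.filter_add, Multiset.filter_eq_self.2 l.pos, Multiset.filter_eq_nil.2,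
    add_zero]
  intro a ha
  simp [Multiset.eq_of_mem_replicate ha]

theorem ext_part {l l' : Ptn} {M : ℕ} (hl : l.length ≤ M) (hl' : l'.length ≤ M)
    (h : ∀ i < M, l.part i = l'.part i) : l = l' := by
  have hp : l.parts = l'.parts := by
    rw [← filter_map_part l hl, ← filter_map_part l' hl']
    congr 1
    exact Multiset.map_congr rfl fun i hi => h i (Multiset.mem_range.1 hi)
  cases l
  cases l'
  simpa using hp

theorem size_eq_sum (l : Ptn) {M : ℕ} (hM : l.length ≤ M) :
    l.size = ∑ i ∈ Finset.range M, l.part i := by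
  have h0 : (((Multiset.range M).map l.part).filter (fun x => ¬ 0 < x)).sum = 0 :=
    Multiset.sum_eq_zero fun x hx => by
      have := (Multiset.mem_filter.1 hx).2
      omega
  have h1 := congrArg Multiset.sum
    (Multiset.filter_add_not (fun x => 0 < x) ((Multiset.range M).map l.part))
  rw [Multiset.sum_add, h0, add_zero, filter_map_part l hM] at h1
  exact h1

end Ptn

/-- The increasing enumeration of the beta-set of `l` with `M` beads. -/
def betaFun (l : Ptn) (M : ℕ) (i : Fin M) : ℕ := l.part (M - 1 - i) + i

theorem betaFun_strictMono (l : Ptn) (M : ℕ) : StrictMono (betaFun l M) := by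
  intro i j hij
  have h := l.part_antitone (show M - 1 - (j : ℕ) ≤ M - 1 - i by omega)
  have : (i : ℕ) < j := hij
  simp only [betaFun]
  omega

theorem image_betaFun (l : Ptn) (M : ℕ) : Finset.univ.image (betaFun l M) = betaSet l M := by
  ext x
  simp only [Finset.mem_image, Finset.mem_univ, true_and, betaSet, Finset.mem_range, betaFun]
  constructor
  · rintro ⟨i, rfl⟩
    exact ⟨M - 1 - i, by omega, by omega⟩
  · rintro ⟨i, hi, rfl⟩
    refine ⟨⟨M - 1 - i, by omega⟩, ?_⟩
    have : M - 1 - (M - 1 - i) = i := by omega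
    simp only [this]

theorem betaFun_mem (l : Ptn) (M : ℕ) (i : Fin M) : betaFun l M i ∈ betaSet l M := by
  rw [← image_betaFun]
  exact Finset.mem_image_of_mem _ (Finset.mem_univ i)

theorem card_betaSet (l : Ptn) (M : ℕ) : (betaSet l M).card = M := by
  rw [← image_betaFun, Finset.card_image_of_injective _ (betaFun_strictMono l M).injective,
    Finset.card_univ, Fintype.card_fin]

theorem eq_betaFun {l : Ptn} {M : ℕ} {f : Fin M → ℕ} (hf : StrictMono f)
    (hm : ∀ i, f i ∈ betaSet l M) : f = betaFun l M := by
  rw [Finset.orderEmbOfFin_unique (card_betaSet l M) hm hf,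
    Finset.orderEmbOfFin_unique (card_betaSet l M) (betaFun_mem l M) (betaFun_strictMono l M)]

theorem betaSet_injective {l l' : Ptn} {M : ℕ} (hl : l.length ≤ M) (hl' : l'.length ≤ M)
    (h : betaSet l M = betaSet l' M) : l = l' := by
  have hb : betaFun l M = betaFun l' M :=
    eq_betaFun (betaFun_strictMono l M) fun i => h ▸ betaFun_mem l M i
  refine Ptn.ext_part hl hl' fun i hi => ?_
  have := congrFun hb ⟨M - 1 - i, by omega⟩
  simp only [betaFun, show M - 1 - (M - 1 - i) = i by omega] at this
  omega

theorem exists_betaSet_eq (B : Finset ℕ) {M : ℕ} (hB : B.card = M) :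
    ∃ l : Ptn, l.length ≤ M ∧ betaSet l M = B := by
  set α := B.orderEmbOfFin hB with hα
  have hgap : ∀ i j : Fin M, i ≤ j → α i + (j - i : ℕ) ≤ α j := by
    intro i j hij
    obtain ⟨i, hi⟩ := i
    obtain ⟨j, hj⟩ := j
    have hij' : i ≤ j := hij
    induction j, hij' using Nat.le_induction with
    | base => simp
    | succ k hk ih =>
      have h1 := ih (by omega) hk
      have h2 : α ⟨k, by omega⟩ < α ⟨k + 1, hj⟩ := α.strictMono (by simp [Fin.lt_def])
      simp only at h1 ⊢
      omega
  have hge : ∀ i : Fin M, (i : ℕ) ≤ α i := by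
    intro i
    have := hgap ⟨0, i.pos⟩ i (by simp [Fin.le_def])
    simp only at this
    omega
  set L : List ℕ := List.ofFn fun i : Fin M => α i.rev - i.rev with hL
  have hsorted : L.Pairwise (· ≥ ·) := by
    rw [hL, List.pairwise_ofFn]
    intro i j hij
    have h1 := hgap j.rev i.rev (by simpa using hij.le)
    have h2 := hge j.rev
    have : (j.rev : ℕ) ≤ i.rev := by
      have : j.rev ≤ i.rev := by simpa using hij.le
      exact this
    omega
  have hlen : (Ptn.of (L : Multiset ℕ)).length ≤ M := by
    have h := Multiset.card_le_card (Multiset.filter_le (fun x => 0 < x) (L : Multiset ℕ))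
    rwa [Multiset.coe_card, hL, List.length_ofFn] at h
  refine ⟨Ptn.of (L : Multiset ℕ), hlen, ?_⟩
  have hfun : betaFun (Ptn.of (L : Multiset ℕ)) M = α := by
    funext i
    have hi : M - 1 - (i : ℕ) < L.length := by simp [hL]; omega
    rw [betaFun, Ptn.part_of hsorted, List.getD_eq_getElem _ _ hi]
    simp only [hL, List.getElem_ofFn]
    have : Fin.rev (⟨M - 1 - (i : ℕ), by omega⟩ : Fin M) = i := by
      ext; simp only [Fin.val_rev]; omega
    rw [this]
    have := hge i
    omega
  rw [← image_betaFun, hfun, hα]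
  ext x
  rw [← Finset.mem_coe (s := B), ← Finset.range_orderEmbOfFin B hB]
  simp

theorem det_hz_succ (l : Ptn) {M : ℕ} (hM : l.length ≤ M) :
    Matrix.det (Matrix.of fun i j : Fin (M + 1) =>
        hz ((l.part i.val : ℤ) + (j.val : ℤ) - (i.val : ℤ)))
      = Matrix.det (Matrix.of fun i j : Fin M =>
        hz ((l.part i.val : ℤ) + (j.val : ℤ) - (i.val : ℤ))) := by
  rw [Matrix.det_succ_row _ (Fin.last M), Finset.sum_eq_single (Fin.last M)]
  · have h1 : hz 0 = 1 := by simp [hz, hSym, zval, pMult]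
    simp only [Fin.val_last, ← two_mul, pow_mul, Matrix.of_apply, Ptn.part_eq_zero hM]
    simp only [Nat.cast_zero, zero_add, sub_self, h1, Fin.succAbove_last]
    rw [neg_one_sq, one_pow, one_mul, one_mul]
    rfl
  · intro j _ hj
    have : j.val < M := Fin.val_lt_last hj
    simp only [Matrix.of_apply, Fin.val_last, Ptn.part_eq_zero hM]
    rw [hz, if_pos (by push_cast; omega)]
    ring
  · simp

theorem schur_eq_det_betaFun (l : Ptn) {M : ℕ} (hM : l.length ≤ M) :
    schur l = Matrix.det (Matrix.of fun i j : Fin M => hz ((betaFun l M i : ℤ) - (j.val : ℤ))) := by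
  have h : schur l = Matrix.det (Matrix.of fun i j : Fin M =>
        hz ((l.part i.val : ℤ) + (j.val : ℤ) - (i.val : ℤ))) := by
    induction M, hM using Nat.le_induction with
    | base => rfl
    | succ k hk ih => rw [ih, det_hz_succ l hk]
  rw [h, ← Matrix.det_submatrix_equiv_self Fin.revPerm]
  congr 1
  ext1 i j
  simp only [Matrix.submatrix_apply, Matrix.of_apply, Fin.revPerm_apply, betaFun, Fin.val_rev]
  congr 1
  have : M - (i.val + 1) = M - 1 - i.val := by omega
  rw [this]
  omega

theorem betaSet_add_two (l : Ptn) {M : ℕ} (hM : l.length ≤ M) (x : ℕ) :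
    x ∈ betaSet l (M + 2) ↔ x < 2 ∨ ∃ y ∈ betaSet l M, x = y + 2 := by
  simp only [betaSet, Finset.mem_image, Finset.mem_range]
  constructor
  · rintro ⟨i, hi, rfl⟩
    by_cases h : i < M
    · exact Or.inr ⟨_, ⟨i, h, rfl⟩, by omega⟩
    · left
      rw [Ptn.part_eq_zero (by omega)]
      omega
  · rintro (h | ⟨y, ⟨i, hi, rfl⟩, rfl⟩)
    · exact ⟨M + 1 - x, by omega, by rw [Ptn.part_eq_zero (by omega)]; omega⟩
    · exact ⟨i, by omega, by omega⟩

theorem rKey_two_shift {B B' : Finset ℕ} (hB : ∀ x, x ∈ B' ↔ x < 2 ∨ ∃ y ∈ B, x = y + 2)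
    (p : ℕ) : rKey 2 B' (p + 2) = rKey 2 B p + 2 := by
  have h : B'.filter (fun q => q % 2 = (p + 2) % 2 ∧ q < p + 2)
      = insert (p % 2) ((B.filter (fun q => q % 2 = p % 2 ∧ q < p)).map (addRightEmbedding 2)) := by
    ext x
    simp only [Finset.mem_filter, hB, Finset.mem_insert, Finset.mem_map, addRightEmbedding_apply]
    constructor
    · rintro ⟨h | ⟨y, hy, rfl⟩, h1, h2⟩
      · left; omega
      · exact Or.inr ⟨y, ⟨hy, by omega, by omega⟩, rfl⟩
    · rintro (h | ⟨y, ⟨hy, h1, h2⟩, rfl⟩)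
      · exact ⟨Or.inl (by omega), by omega, by omega⟩
      · exact ⟨Or.inr ⟨y, hy, rfl⟩, by omega, by omega⟩
  rw [rKey, h, Finset.card_insert_of_notMem, Finset.card_map, rKey]
  · omega
  · simp only [Finset.mem_map, addRightEmbedding_apply, not_exists, not_and]
    intro y _
    omega

theorem inversions_shift {B B' : Finset ℕ} (hB : ∀ x, x ∈ B' ↔ x < 2 ∨ ∃ y ∈ B, x = y + 2) :
    inversions (rKey 2 B') B' = inversions (rKey 2 B) B := by
  have hsmall : ∀ p < 2, rKey 2 B' p = p := by
    intro p hp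
    have : B'.filter (fun q => q % 2 = p % 2 ∧ q < p) = ∅ := by
      rw [Finset.filter_eq_empty_iff]
      intro q _
      omega
    rw [rKey, this, Finset.card_empty]
    omega
  symm
  refine Finset.card_bij (fun x _ => (x.1 + 2, x.2 + 2)) ?_ ?_ ?_
  · rintro ⟨x, y⟩ h
    simp only [Finset.mem_filter, Finset.mem_product, hB, rKey_two_shift hB] at h ⊢
    exact ⟨⟨Or.inr ⟨x, h.1.1, rfl⟩, Or.inr ⟨y, h.1.2, rfl⟩⟩, by omega, by omega⟩
  · rintro ⟨x, y⟩ _ ⟨x', y'⟩ _ h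
    simpa using h
  · rintro ⟨x, y⟩ h
    simp only [Finset.mem_filter, Finset.mem_product] at h
    obtain ⟨⟨hx, hy⟩, hlt, hk⟩ := h
    rcases (hB x).1 hx with hx' | ⟨x, hx', rfl⟩
    · rw [hsmall x hx'] at hk
      rcases (hB y).1 hy with hy' | ⟨y, hy', rfl⟩
      · rw [hsmall y hy'] at hk; omega
      · rw [rKey_two_shift hB] at hk; omega
    · rcases (hB y).1 hy with hy' | ⟨y, hy', rfl⟩
      · omega
      · rw [rKey_two_shift hB, rKey_two_shift hB] at hk
        exact ⟨(x, y), by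
          simp only [Finset.mem_filter, Finset.mem_product]
          exact ⟨⟨hx', hy'⟩, by omega, by omega⟩, rfl⟩

/-- The `2`-sign may be computed with any even number of beads. -/
theorem rSign_two_eq (l : Ptn) {k : ℕ} (hk : l.length ≤ 2 * k) :
    rSign 2 l = (-1) ^ inversions (rKey 2 (betaSet l (2 * k))) (betaSet l (2 * k)) := by
  have step : ∀ d, ∀ k, l.length ≤ 2 * k →
      inversions (rKey 2 (betaSet l (2 * (k + d)))) (betaSet l (2 * (k + d)))
        = inversions (rKey 2 (betaSet l (2 * k))) (betaSet l (2 * k)) := by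
    intro d k hk
    induction d with
    | zero => rfl
    | succ d ih => 
      rw [← ih]
      exact inversions_shift (betaSet_add_two l (M := 2 * (k + d)) (by omega))
  rw [rSign, rSignExp, ← step k l.length (by omega), ← step l.length k hk, add_comm]

/-- Reordering the rows of a determinant, with the sign expressed through inversions. -/
theorem det_rows_reorder {R : Type*} [CommRing R] {K : ℕ} {α p : Fin K → ℕ} (hα : StrictMono α)
    (hp : Function.Injective p) (him : ∀ i, ∃ j, α j = p i) (r : ℕ → Fin K → R) :
    Matrix.det (Matrix.of fun i => r (α i))
      = ((∏ j, ∏ i ∈ Finset.Iio j, Int.sign ((p j : ℤ) - p i) : ℤ) : R) *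
        Matrix.det (Matrix.of fun i => r (p i)) := by
  choose σ hσ using him
  have hinj : Function.Injective σ := fun i j h => hp (by rw [← hσ i, ← hσ j, h])
  set τ := Equiv.ofBijective σ (Finite.injective_iff_bijective.1 hinj) with hτ
  have hτ' : ∀ i, p i = α (τ i) := fun i => (hσ i).symm
  have h1 := Equiv.Perm.prod_Iio_comp_eq_sign_mul_prod τ
    (f := fun i j => Int.sign ((α j : ℤ) - α i)) (fun i j => by
      rw [← Int.sign_neg, neg_sub])
  have h2 : ∏ j, ∏ i ∈ Finset.Iio j, Int.sign ((α j : ℤ) - α i) = 1 := by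
    refine Finset.prod_eq_one fun j _ => Finset.prod_eq_one fun i hi => ?_
    have := hα (Finset.mem_Iio.1 hi)
    exact Int.sign_eq_one_of_pos (by omega)
  rw [h2, mul_one] at h1
  have h3 := Matrix.det_permute τ (Matrix.of fun i => r (α i))
  have h4 : (Matrix.of fun i => r (p i)) = (Matrix.of fun i => r (α i)).submatrix τ id := by
    ext i j
    simp [hτ']
  simp only [hτ', h1]
  simp only [hτ'] at h4
  rw [h4, h3, ← mul_assoc, ← Int.cast_mul]
  simp

theorem prod_sign_eq_neg_one_pow_inversions {K : ℕ} {p : Fin K → ℕ} (hp : Function.Injective p)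
    {B : Finset ℕ} (hB : ∀ x, x ∈ B ↔ ∃ i, p i = x) {key : ℕ → ℕ} (hkey : ∀ i, key (p i) = i) :
    ∏ j, ∏ i ∈ Finset.Iio j, Int.sign ((p j : ℤ) - p i) = (-1) ^ inversions key B := by
  rw [Finset.prod_sigma']
  have h : ∀ x ∈ (Finset.univ : Finset (Fin K)).sigma (fun j => Finset.Iio j),
      Int.sign ((p x.1 : ℤ) - p x.2) = if p x.1 < p x.2 then -1 else 1 := by
    rintro ⟨j, i⟩ hx
    have hij : i < j := by simpa using hx
    have : p i ≠ p j := fun h => hij.ne (hp h)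
    dsimp only
    split_ifs with h
    · exact Int.sign_eq_neg_one_of_neg (by omega)
    · exact Int.sign_eq_one_of_pos (by omega)
  rw [Finset.prod_congr rfl h, Finset.prod_ite, Finset.prod_const_one, mul_one,
    Finset.prod_const]
  congr 1
  refine Finset.card_bij (fun x _ => (p x.1, p x.2)) ?_ ?_ ?_
  · rintro ⟨j, i⟩ hx
    simp only [Finset.mem_filter, Finset.mem_sigma, Finset.mem_univ, true_and, Finset.mem_Iio,
      Finset.mem_product, hkey, hB] at hx ⊢
    exact ⟨⟨⟨j, rfl⟩, ⟨i, rfl⟩⟩, hx.2, hx.1⟩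
  · rintro ⟨j, i⟩ _ ⟨j', i'⟩ _ h
    simp only [Prod.mk.injEq] at h
    rw [hp h.1, hp h.2]
  · rintro ⟨x, y⟩ hx
    simp only [Finset.mem_filter, Finset.mem_product, hB] at hx
    obtain ⟨⟨⟨j, rfl⟩, ⟨i, rfl⟩⟩, h1, h2⟩ := hx
    rw [hkey, hkey] at h2
    exact ⟨⟨j, i⟩, by simpa using ⟨h2, h1⟩, rfl⟩

/-- Listing the beads in the order of the `2`-numbering absorbs the `2`-sign. -/
theorem rSign_smul_schur {l : Ptn} {n : ℕ} (hl : l.length ≤ n * 2) {p : Fin (n * 2) → ℕ}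
    (hp : Function.Injective p) (hB : ∀ x, x ∈ betaSet l (n * 2) ↔ ∃ i, p i = x)
    (hkey : ∀ i, rKey 2 (betaSet l (n * 2)) (p i) = i) :
    rSign 2 l • schur l
      = Matrix.det (Matrix.of fun i j : Fin (n * 2) => hz ((p i : ℤ) - (j.val : ℤ))) := by
  have him : ∀ i, ∃ j, betaFun l (n * 2) j = p i := by
    intro i
    have : p i ∈ betaSet l (n * 2) := (hB _).2 ⟨i, rfl⟩
    rw [← image_betaFun] at this
    simpa using this
  have hs : rSign 2 l
      = (-1) ^ inversions (rKey 2 (betaSet l (n * 2))) (betaSet l (n * 2)) := by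
    rw [rSign_two_eq l (k := n) (by omega), mul_comm 2 n]
  rw [schur_eq_det_betaFun l hl, det_rows_reorder (betaFun_strictMono l _) hp him
    (fun x (j : Fin (n * 2)) => hz ((x : ℤ) - (j.val : ℤ))),
    prod_sign_eq_neg_one_pow_inversions hp hB hkey, ← hs, zsmul_eq_mul, ← mul_assoc,
    ← Int.cast_mul]
  have : rSign 2 l * rSign 2 l = 1 := by
    rw [rSign, ← mul_pow]
    simp
  rw [this, Int.cast_one, one_mul]

/-- The beads attached to `E`: the even positions `2s` and their mirror images, `s ∈ E`. -/
def balancedBeads (n m : ℕ) (E : Finset (Fin (n + m))) : Finset ℕ :=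
  E.image (fun s : Fin (n + m) => 2 * (s : ℕ)) ∪ E.image (fun s : Fin (n + m) => 2 * m + 2 * n - 1 - 2 * (s : ℕ))

theorem mem_balancedBeads {n m : ℕ} {E : Finset (Fin (n + m))} {x : ℕ} :
    x ∈ balancedBeads n m E ↔
      (∃ s ∈ E, x = 2 * (s : ℕ)) ∨ ∃ s ∈ E, x = 2 * m + 2 * n - 1 - 2 * (s : ℕ) := by
  simp [balancedBeads, eq_comm]

theorem card_balancedBeads {n m : ℕ} (E : Finset (Fin (n + m))) :
    (balancedBeads n m E).card = E.card * 2 := by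
  rw [balancedBeads, Finset.card_union_of_disjoint, Finset.card_image_of_injective,
    Finset.card_image_of_injective, mul_two]
  · intro s t h
    ext
    have := s.2
    have := t.2
    simp only at h
    omega
  · intro s t h
    ext
    simp only at h
    omega
  · rw [Finset.disjoint_left]
    intro x h1 h2
    simp only [Finset.mem_image] at h1 h2
    obtain ⟨s, _, rfl⟩ := h1
    obtain ⟨t, _, h⟩ := h2
    have := t.2
    omega

theorem balancedBeads_injective {n m : ℕ} : Function.Injective (balancedBeads n m) := by
  have key : ∀ (E : Finset (Fin (n + m))) (s : Fin (n + m)),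
      2 * (s : ℕ) ∈ balancedBeads n m E ↔ s ∈ E := by
    intro E s
    rw [mem_balancedBeads]
    constructor
    · rintro (⟨t, ht, h⟩ | ⟨t, ht, h⟩)
      · have : s = t := by ext; omega
        rwa [this]
      · have := t.2
        omega
    · exact fun h => Or.inl ⟨s, h, rfl⟩
  intro E E' h
  ext s
  rw [← key, ← key, h]

theorem mem_W_iff_exists {n m : ℕ} {l : Ptn} :
    l ∈ W n m ↔ l.length ≤ n * 2 ∧
      ∃ E : Finset (Fin (n + m)), E.card = n ∧ betaSet l (n * 2) = balancedBeads n m E := by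
  constructor
  · rintro ⟨-, hlen, hW⟩
    have hlen' : l.length ≤ n * 2 := by omega
    refine ⟨hlen', Finset.univ.filter (fun s => 2 * (s : ℕ) ∈ betaSet l (n * 2)), ?_⟩
    have hW' : ∀ i < n * 2, l.part i + l.part (n * 2 - 1 - i) = 2 * m := by
      intro i hi
      by_cases h : i < n
      · rw [← hW i h, mul_comm n 2]
      · have := hW (n * 2 - 1 - i) (by omega)
        rw [← this, add_comm]
        congr 2
        omega
    have hsymm : ∀ x ∈ betaSet l (n * 2), x < 2 * m + 2 * n ∧
        2 * m + 2 * n - 1 - x ∈ betaSet l (n * 2) := by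
      intro x hx
      simp only [betaSet, Finset.mem_image, Finset.mem_range] at hx ⊢
      obtain ⟨i, hi, rfl⟩ := hx
      have := hW' i hi
      exact ⟨by omega, n * 2 - 1 - i, by omega, by omega⟩
    have hE : betaSet l (n * 2) = balancedBeads n m
        (Finset.univ.filter (fun s => 2 * (s : ℕ) ∈ betaSet l (n * 2))) := by
      ext x
      simp only [mem_balancedBeads, Finset.mem_filter, Finset.mem_univ, true_and]
      constructor
      · intro hx
        obtain ⟨hx1, hx2⟩ := hsymm x hx
        rcases Nat.even_or_odd' x with ⟨s, rfl | rfl⟩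
        · exact Or.inl ⟨⟨s, by omega⟩, hx, rfl⟩
        · refine Or.inr ⟨⟨m + n - 1 - s, by omega⟩, ?_, ?_⟩
          · convert hx2 using 1
            simp only
            omega
          · simp only
            omega
      · rintro (⟨s, hs, rfl⟩ | ⟨s, hs, rfl⟩)
        · exact hs
        · exact (hsymm _ hs).2
    refine ⟨?_, hE⟩
    have := card_betaSet l (n * 2)
    rw [hE, card_balancedBeads] at this
    omega
  · rintro ⟨hlen, E, hE, hB⟩
    have hle : ∀ x ∈ betaSet l (n * 2), x ≤ 2 * m + 2 * n - 1 ∧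
        2 * m + 2 * n - 1 - x ∈ betaSet l (n * 2) := by
      intro x hx
      rw [hB, mem_balancedBeads] at hx ⊢
      rcases hx with ⟨s, hs, rfl⟩ | ⟨s, hs, rfl⟩
      · have := s.2
        exact ⟨by omega, Or.inr ⟨s, hs, rfl⟩⟩
      · have := s.2
        exact ⟨by omega, Or.inl ⟨s, hs, by omega⟩⟩
    have hrev : (fun i : Fin (n * 2) => 2 * m + 2 * n - 1 - betaFun l (n * 2) i.rev)
        = betaFun l (n * 2) := by
      refine eq_betaFun ?_ fun i => (hle _ (betaFun_mem l _ _)).2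
      intro i j hij
      have h1 := betaFun_strictMono l (n * 2) (Fin.rev_lt_rev.2 hij)
      have h2 := (hle _ (betaFun_mem l (n * 2) i.rev)).1
      simp only
      omega
    have hpart : ∀ i < n * 2, l.part i + l.part (n * 2 - 1 - i) = 2 * m := by
      intro i hi
      have h1 := congrFun hrev ⟨i, hi⟩
      have h2 := (hle _ (betaFun_mem l (n * 2) (Fin.rev ⟨i, hi⟩))).1
      simp only [betaFun, Fin.val_rev] at h1 h2
      rw [show n * 2 - 1 - (n * 2 - (i + 1)) = i by omega] at h1 h2
      omega
    refine ⟨?_, by omega, fun i hi => by rw [mul_comm 2 n]; exact hpart i (by omega)⟩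
    have h1 := l.size_eq_sum hlen
    have h2 : ∑ i ∈ Finset.range (n * 2), l.part (n * 2 - 1 - i)
        = ∑ i ∈ Finset.range (n * 2), l.part i := Finset.sum_range_reflect _ _
    have h3 := Finset.sum_congr rfl fun i hi => hpart i (Finset.mem_range.1 hi)
    rw [Finset.sum_add_distrib, h2, ← h1, Finset.sum_const, Finset.card_range, smul_eq_mul] at h3
    nlinarith

/-- The beads attached to an increasing `e`, in the order of the `2`-numbering. -/
def keyOrder (n m : ℕ) (e : Fin n → Fin (n + m)) (x : Fin n × Fin 2) : ℕ :=
  if x.2 = 0 then 2 * (e x.1 : ℕ) else 2 * m + 2 * n - 1 - 2 * (e x.1.rev : ℕ)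

theorem keyOrder_mod_two {n m : ℕ} (e : Fin n → Fin (n + m)) (i : Fin n) (c : Fin 2) :
    keyOrder n m e (i, c) % 2 = c := by
  have := (e i.rev).2
  fin_cases c
  · simp [keyOrder]
  · simp [keyOrder]; omega

theorem keyOrder_strictMono {n m : ℕ} {e : Fin n → Fin (n + m)} (he : StrictMono e) (c : Fin 2) :
    StrictMono fun i => keyOrder n m e (i, c) := by
  intro i j hij
  have h1 : (e i : ℕ) < e j := he hij
  have h2 : (e j.rev : ℕ) < e i.rev := he (Fin.rev_lt_rev.2 hij)
  have := (e i.rev).2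
  fin_cases c
  · simpa [keyOrder] using h1
  · simp [keyOrder]; omega

theorem keyOrder_injective {n m : ℕ} {e : Fin n → Fin (n + m)} (he : StrictMono e) :
    Function.Injective (keyOrder n m e) := by
  rintro ⟨i, c⟩ ⟨j, d⟩ h
  have hcd : c = d := by
    ext
    rw [← keyOrder_mod_two e i c, ← keyOrder_mod_two e j d, h]
  subst hcd
  rw [(keyOrder_strictMono he c).injective h]

theorem mem_balancedBeads_iff_keyOrder {n m : ℕ} {E : Finset (Fin (n + m))} (hE : E.card = n)
    (x : ℕ) : x ∈ balancedBeads n m E ↔ ∃ y, keyOrder n m (E.orderEmbOfFin hE) y = x := by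
  have hmem : ∀ s, s ∈ E ↔ ∃ i, E.orderEmbOfFin hE i = s := by
    intro s
    rw [← Finset.mem_coe, ← Finset.range_orderEmbOfFin E hE]
    rfl
  rw [mem_balancedBeads]
  constructor
  · rintro (⟨s, hs, rfl⟩ | ⟨s, hs, rfl⟩)
    · obtain ⟨i, rfl⟩ := (hmem s).1 hs
      exact ⟨(i, 0), by simp [keyOrder]⟩
    · obtain ⟨i, rfl⟩ := (hmem s).1 hs
      exact ⟨(i.rev, 1), by simp [keyOrder]⟩
  · rintro ⟨⟨i, c⟩, rfl⟩
    fin_cases c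
    · exact Or.inl ⟨_, (hmem _).2 ⟨i, rfl⟩, by simp [keyOrder]⟩
    · exact Or.inr ⟨_, (hmem _).2 ⟨i.rev, rfl⟩, by simp [keyOrder]⟩

theorem rKey_keyOrder {n m : ℕ} {E : Finset (Fin (n + m))} (hE : E.card = n)
    (i : Fin n) (c : Fin 2) :
    rKey 2 (balancedBeads n m E) (keyOrder n m (E.orderEmbOfFin hE) (i, c)) = c + 2 * i := by
  have hmono : ∀ c, StrictMono fun i => keyOrder n m (E.orderEmbOfFin hE) (i, c) :=
    keyOrder_strictMono (E.orderEmbOfFin hE).strictMono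
  have h : (balancedBeads n m E).filter
      (fun q => q % 2 = keyOrder n m (E.orderEmbOfFin hE) (i, c) % 2 ∧
        q < keyOrder n m (E.orderEmbOfFin hE) (i, c))
      = (Finset.Iio i).image fun j => keyOrder n m (E.orderEmbOfFin hE) (j, c) := by
    ext x
    simp only [Finset.mem_filter, mem_balancedBeads_iff_keyOrder hE, Finset.mem_image,
      Finset.mem_Iio]
    constructor
    · rintro ⟨⟨⟨j, d⟩, rfl⟩, h1, h2⟩
      rw [keyOrder_mod_two, keyOrder_mod_two] at h1
      have : d = c := Fin.ext h1
      subst this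
      exact ⟨j, (hmono d).lt_iff_lt.1 h2, rfl⟩
    · rintro ⟨j, hj, rfl⟩
      exact ⟨⟨_, rfl⟩, by rw [keyOrder_mod_two, keyOrder_mod_two], hmono c hj⟩
  rw [rKey, h, Finset.card_image_of_injective _ (hmono c).injective, Fin.card_Iio,
    keyOrder_mod_two, add_comm]

/-- The Jacobi–Trudi row attached to a bead at position `x`. -/
noncomputable def hzRow {n : ℕ} (x : ℕ) (y : Fin n × Fin 2) : SymF :=
  hz ((x : ℤ) - ((y.2.val + 2 * y.1.val : ℕ) : ℤ))

theorem rSign_smul_schur_eq_pairDet {n m : ℕ} {l : Ptn} (hl : l.length ≤ n * 2)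
    {E : Finset (Fin (n + m))} (hE : E.card = n)
    (hB : betaSet l (n * 2) = balancedBeads n m E) :
    rSign 2 l • schur l = ((Equiv.Perm.sign (Fin.revPerm : Equiv.Perm (Fin n)) : ℤ) : SymF) *
      pairDet (fun s : Fin (n + m) => hzRow (2 * (s : ℕ)))
        (fun s => hzRow (2 * m + 2 * n - 1 - 2 * (s : ℕ))) (E.orderEmbOfFin hE) := by
  rw [rSign_smul_schur hl
    (p := keyOrder n m (E.orderEmbOfFin hE) ∘ (finProdFinEquiv : Fin n × Fin 2 ≃ _).symm)
    ((keyOrder_injective (E.orderEmbOfFin hE).strictMono).comp (Equiv.injective _)) ?_ ?_]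
  · rw [← Matrix.det_submatrix_equiv_self (finProdFinEquiv : Fin n × Fin 2 ≃ _)]
    have := Matrix.det_permute
      (Equiv.prodCongrLeft fun c : Fin 2 => if c = 0 then 1 else (Fin.revPerm : Equiv.Perm (Fin n)))
      (Matrix.of fun x : Fin n × Fin 2 =>
        if x.2 = 0 then hzRow (n := n) (2 * (E.orderEmbOfFin hE x.1 : ℕ))
        else hzRow (2 * m + 2 * n - 1 - 2 * (E.orderEmbOfFin hE x.1 : ℕ)))
    rw [Equiv.Perm.sign_prodCongrLeft, Fin.prod_univ_two, if_pos rfl, if_neg one_ne_zero,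
      Equiv.Perm.sign_one, one_mul] at this
    rw [pairDet, ← this]
    congr 1
    ext1 ⟨i, c⟩ ⟨j, d⟩
    simp only [Matrix.submatrix_apply, Matrix.of_apply, Function.comp_apply,
      Equiv.symm_apply_apply]
    fin_cases c <;> simp [keyOrder, hzRow]
  · intro x
    rw [hB, mem_balancedBeads_iff_keyOrder hE]
    exact (Equiv.exists_congr_left finProdFinEquiv)
  · intro i
    obtain ⟨⟨i, c⟩, rfl⟩ := (finProdFinEquiv : Fin n × Fin 2 ≃ _).surjective i
    rw [hB, Function.comp_apply, Equiv.symm_apply_apply, rKey_keyOrder]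
    rfl

theorem sum_range_two_mul {M : Type*} [AddCommMonoid M] (f : ℕ → M) (K : ℕ) :
    ∑ x ∈ Finset.range (2 * K), f x
      = ∑ s ∈ Finset.range K, (f (2 * s) + f (2 * K - 1 - 2 * s)) := by
  have h : ∑ x ∈ Finset.range (2 * K), f x
      = ∑ s ∈ Finset.range K, f (2 * s) + ∑ s ∈ Finset.range K, f (2 * s + 1) := by
    induction K with
    | zero => simp
    | succ K ih =>
      rw [mul_add, mul_one, Finset.sum_range_succ, Finset.sum_range_succ, ih,
        Finset.sum_range_succ, Finset.sum_range_succ]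
      abel
  rw [h, Finset.sum_add_distrib, ← Finset.sum_range_reflect (fun s => f (2 * s + 1))]
  congr 1
  refine Finset.sum_congr rfl fun s hs => ?_
  have := Finset.mem_range.1 hs
  congr 1
  omega

/-- The antisymmetric form attached to the rows `hzRow`. -/
theorem sum_hzRow {n m : ℕ} (hn : 1 ≤ n) (x y : Fin n × Fin 2) :
    ∑ s : Fin (n + m), (hzRow (2 * (s : ℕ)) x * hzRow (2 * m + 2 * n - 1 - 2 * (s : ℕ)) y
        - hzRow (2 * (s : ℕ)) y * hzRow (2 * m + 2 * n - 1 - 2 * (s : ℕ)) x)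
      = (-1) ^ (x.2 : ℕ) * if (x.2.val + y.2.val) % 2 = 1 then
          plethHom 2 (hz ((m : ℤ) + n - 1 - x.1.val - y.1.val)) else 0 := by
  have h := sum_alternating_hz (2 * m + 2 * n - 1) (x.2.val + 2 * x.1.val)
    (y.2.val + 2 * y.1.val)
  rw [show 2 * m + 2 * n - 1 + 1 = 2 * (n + m) by omega, sum_range_two_mul,
    ← Fin.sum_univ_eq_sum_range (fun s => (-1 : SymF) ^ (2 * s) * _ + _)] at h
  refine Eq.trans ?_ (h.trans ?_)
  · refine Finset.sum_congr rfl fun s _ => ?_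
    have hs := s.2
    have hodd : Odd (2 * (n + m) - 1 - 2 * (s : ℕ)) := ⟨n + m - 1 - s, by omega⟩
    rw [hodd.neg_one_pow, pow_mul, neg_one_sq, one_pow]
    rw [show 2 * m + 2 * n - 1 - (2 * (n + m) - 1 - 2 * (s : ℕ)) = 2 * s by omega,
      show 2 * (n + m) - 1 - 2 * (s : ℕ) = 2 * m + 2 * n - 1 - 2 * s by omega]
    simp only [hzRow]
    ring
  · rw [pow_add, pow_mul, neg_one_sq, one_pow, mul_one]
    congr 1
    by_cases hc : (x.2.val + y.2.val) % 2 = 1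
    · rw [if_pos hc, if_pos (by omega)]
      congr 2
      omega
    · rw [if_neg hc, if_neg (by omega)]

theorem schur_rect (n m : ℕ) :
    schur (rect n m) = Matrix.det (Matrix.of fun i j : Fin n => hz ((m : ℤ) + i.val - j.val)) := by
  have hlen : (rect n m).length ≤ n := by
    have h := Multiset.card_le_card
      (Multiset.filter_le (fun x => 0 < x) (Multiset.replicate n m))
    rwa [Multiset.card_replicate] at h
  rw [schur_eq_det_betaFun _ hlen]
  congr 1
  ext1 i j
  have hpart : (rect n m).part (n - 1 - i) = m := by
    rw [rect, ← Multiset.coe_replicate, Ptn.part_of (List.pairwise_replicate.2 (Or.inr le_rfl)),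
      List.getD_eq_getElem _ _ (by simp; omega), List.getElem_replicate]
  simp only [Matrix.of_apply, betaFun, hpart]
  push_cast
  rfl

/-- Proposition 6.4 (Carré–Leclerc, Carini–Remmel): for positive `n`, `m`,
`p_2 ∘ S_{□(n,m)} = Σ_{μ ∈ W(n,m)} δ_2(μ) S_μ`. -/
theorem stmt5 (n m : ℕ) (hn : 1 ≤ n) (hm : 1 ≤ m) :
    pleth 2 (schur (rect n m)) = ∑ᶠ μ ∈ W n m, rSign 2 μ • schur μ := by
  have hex : ∀ E : {E : Finset (Fin (n + m)) // E.card = n}, ∃ l : Ptn, l.length ≤ n * 2 ∧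
      betaSet l (n * 2) = balancedBeads n m E.1 := fun E =>
    exists_betaSet_eq _ (by rw [card_balancedBeads, E.2])
  choose g hglen hgB using hex
  have hginj : Function.Injective g := by
    intro E E' h
    apply Subtype.ext
    apply balancedBeads_injective
    rw [← hgB, ← hgB, h]
  have hrange : W n m = Set.range g := by
    ext l
    rw [mem_W_iff_exists]
    constructor
    · rintro ⟨hl, E, hE, hB⟩
      exact ⟨⟨E, hE⟩, betaSet_injective (hglen _) hl (by rw [hgB, hB])⟩
    · rintro ⟨E, rfl⟩
      exact ⟨hglen E, E.1, E.2, hgB E⟩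
  set C : Matrix (Fin n) (Fin n) SymF := Matrix.of fun j k =>
    plethHom 2 (hz ((m : ℤ) + n - 1 - j.val - k.val)) with hC
  have hdet := sum_pairDet_eq_det (fun s : Fin (n + m) => hzRow (2 * (s : ℕ)))
    (fun s => hzRow (2 * m + 2 * n - 1 - 2 * (s : ℕ))) C
    (fun j k => by rw [sum_hzRow hn]; simp [hC]) (fun j k => by rw [sum_hzRow hn]; simp)
    (fun j k => by rw [sum_hzRow hn]; simp)
  rw [hrange, finsum_mem_range hginj, finsum_eq_sum_of_fintype,
    Finset.sum_congr rfl fun E _ => rSign_smul_schur_eq_pairDet (hglen E) E.2 (hgB E),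
    ← Finset.mul_sum, hdet, ← Matrix.det_permute, pleth_eq, schur_rect, AlgHom.map_det]
  congr 1
  ext1 i j
  simp only [hC, AlgHom.mapMatrix_apply, Matrix.map_apply, Matrix.of_apply,
    Matrix.submatrix_apply, Fin.revPerm_apply, Fin.val_rev, id_eq]
  congr 2
  omega
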